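/- Let f be standard self-concordant on an open convex set dom f ⊆ ℝⁿ, g : ℝⁿ → ℝ ∪ {+∞} proper, lower semicontinuous and convex, F := f + g, and let x* satisfy 0 ∈ ∇f(x*) + ∂g(x*) with ∇²f(x*) ≻ 0. For x^k ∈ dom F with r_k := ‖x^k − x*‖_{x*} < 1, a symmetric positive definite matrix H_k, and s^k := P^g_{H_k}(H_k x^k − ∇f(x^k)), d^k := s^k − x^k, one has ‖s^k − x*‖_{x*} ≤ r_k²/(1 − r_k) + ‖(H_k − ∇²f(x*)) d^k‖*_{x*}. -/

import Mathlib

open Matrix Set Filter Topology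

noncomputable section

variable {n : ℕ}

/-- Weighted (semi)norm induced by a matrix `H`: `‖z‖_H = √(zᵀ H z)`. -/
def mNorm (H : Matrix (Fin n) (Fin n) ℝ) (z : Fin n → ℝ) : ℝ :=
  Real.sqrt (z ⬝ᵥ H.mulVec z)

/-- Dual weighted norm, `‖z‖*_H = √(zᵀ H⁻¹ z)`. -/
def mDualNorm (H : Matrix (Fin n) (Fin n) ℝ) (z : Fin n → ℝ) : ℝ :=
  Real.sqrt (z ⬝ᵥ H⁻¹.mulVec z)

/-- A function `g : ℝⁿ → ℝ ∪ {+∞}` (modelled with values in `EReal`) is proper. -/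
def EProper (g : (Fin n → ℝ) → EReal) : Prop :=
  (∀ x, g x ≠ ⊥) ∧ ∃ x, g x ≠ ⊤

/-- Convexity of an `EReal`-valued function on `ℝⁿ`. -/
def EConvex (g : (Fin n → ℝ) → EReal) : Prop :=
  ∀ x y : Fin n → ℝ, ∀ a b : ℝ, 0 ≤ a → 0 ≤ b → a + b = 1 →
    g (a • x + b • y) ≤ (a : EReal) * g x + (b : EReal) * g y

/-- `v` is a subgradient of `g` at `x`. -/
def ESubgradAt (g : (Fin n → ℝ) → EReal) (v x : Fin n → ℝ) : Prop :=
  g x ≠ ⊤ ∧ ∀ y, g x + ((v ⬝ᵥ (y - x) : ℝ) : EReal) ≤ g y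

/-- Objective of the proximal subproblem `g(x) + ½ xᵀHx − uᵀx`. -/
def proxObj (H : Matrix (Fin n) (Fin n) ℝ) (g : (Fin n → ℝ) → EReal)
    (u x : Fin n → ℝ) : EReal :=
  g x + ((1 / 2 * (x ⬝ᵥ H.mulVec x) - u ⬝ᵥ x : ℝ) : EReal)

/-- `p` solves the proximal subproblem, i.e. `p = P^g_H(u)`. -/
def IsProxPt (H : Matrix (Fin n) (Fin n) ℝ) (g : (Fin n → ℝ) → EReal)
    (u p : Fin n → ℝ) : Prop :=
  ∀ x, proxObj H g u p ≤ proxObj H g u x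

/-- The continuous linear map `y ↦ vᵀy`. -/
def dotCLM (v : Fin n → ℝ) : (Fin n → ℝ) →L[ℝ] ℝ :=
  LinearMap.toContinuousLinearMap
    { toFun := fun y => v ⬝ᵥ y
      map_add' := fun a b => dotProduct_add v a b
      map_smul' := fun c a => by simp }

/-- `f` is standard self-concordant on the open convex set `D`. -/
def StdSelfConcordantOn (D : Set (Fin n → ℝ)) (f : (Fin n → ℝ) → ℝ) : Prop :=
  IsOpen D ∧ Convex ℝ D ∧ ConvexOn ℝ D f ∧ ContDiffOn ℝ 3 f D ∧
    ∀ x ∈ D, ∀ v : Fin n → ℝ, ∀ t : ℝ, x + t • v ∈ D →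
      |iteratedDeriv 3 (fun s : ℝ => f (x + s • v)) t| ≤
        2 * iteratedDeriv 2 (fun s : ℝ => f (x + s • v)) t ^ ((3 : ℝ) / 2)

open scoped Classical in
/-- The extended objective `F = f + g`, equal to `+∞` outside `dom f`. -/
def Fext (D : Set (Fin n → ℝ)) (f : (Fin n → ℝ) → ℝ) (g : (Fin n → ℝ) → EReal)
    (x : Fin n → ℝ) : EReal :=
  if x ∈ D then (f x : EReal) + g x else ⊤

def omega (t : ℝ) : ℝ := t - Real.log (1 + t)

def omegaStar (t : ℝ) : ℝ := -t - Real.log (1 - t)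

/-- A binary cubic form bounded by `M` on the unit circle has its polar form `T(v, v, h)` bounded by
`M` for unit `v, h`: the polar value is a convex combination of three values on the circle. -/
theorem abs_mixed_coeff_le_of_circle {a b c d M : ℝ} (x y : ℝ) (hxy : x^2+y^2=1)
    (h : ∀ x y : ℝ, x^2+y^2=1 → |a*x^3+3*b*x^2*y+3*c*x*y^2+d*y^3| ≤ M) :
    |a*x+b*y| ≤ M := by
  obtain ⟨ψ, h1, h2⟩ : ∃ ψ : ℝ, x = Real.cos (3*ψ) ∧ y = Real.sin (3*ψ) := by
    have hz : ‖(⟨x,y⟩:ℂ)‖ = 1 := by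
      rw [Complex.norm_def, Complex.normSq_mk, ← sq, ← sq, hxy, Real.sqrt_one]
    refine ⟨Complex.arg ⟨x,y⟩ / 3, ?_, ?_⟩
    · have := Complex.norm_mul_cos_arg ⟨x,y⟩
      rw [hz, one_mul] at this
      rw [mul_div_cancel₀ _ (by norm_num), this]
    · have := Complex.norm_mul_sin_arg ⟨x,y⟩
      rw [hz, one_mul] at this
      rw [mul_div_cancel₀ _ (by norm_num), this]
  rw [Real.cos_three_mul] at h1
  rw [Real.sin_three_mul] at h2
  have hcs := Real.sin_sq_add_cos_sq ψ
  set C := Real.cos ψ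
  set S := Real.sin ψ
  obtain ⟨k, hk⟩ : ∃ k : ℝ, k^2 = 3 := ⟨Real.sqrt 3, by norm_num⟩
  have e0 := h C S (by linarith)
  have e1 := h (-C/2 - k/2*S) (-S/2 + k/2*C) (by linear_combination (1/4 + k^2/4) * hcs + (1/4)*hk)
  have e2 := h (-C/2 + k/2*S) (-S/2 - k/2*C) (by linear_combination (1/4 + k^2/4) * hcs + (1/4)*hk)
  have key : ∀ w p : ℝ, |p| ≤ M → |w^2/9*p| ≤ w^2/9*M := by
    intro w p hp
    rw [abs_mul, abs_of_nonneg (by positivity)]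
    gcongr
  have f0 := key (4*C^2-1) _ e0
  have f1 := key (4*(-C/2 - k/2*S)^2-1) _ e1
  have f2 := key (4*(-C/2 + k/2*S)^2-1) _ e2
  have hS2 : S^2 = 1 - C^2 := by linarith
  have hk4 : k^4 = 9 := by rw [show k^4=(k^2)^2 by ring, hk]; norm_num
  have hk6 : k^6 = 27 := by rw [show k^6=(k^2)^3 by ring, hk]; norm_num
  have hS4 : S^4 = (1-C^2)^2 := by rw [← hS2]; ring
  have hS6 : S^6 = (1-C^2)^3 := by rw [← hS2]; ring
  have hS3 : S^3 = S * (1-C^2) := by rw [← hS2]; ring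
  have hS5 : S^5 = S * (1-C^2)^2 := by rw [← hS2]; ring
  have hS7 : S^7 = S * (1-C^2)^3 := by rw [← hS2]; ring
  have hsum : (4*C^2-1)^2/9 + (4*(-C/2 - k/2*S)^2-1)^2/9 + (4*(-C/2 + k/2*S)^2-1)^2/9 = 1 := by
    ring_nf; simp only [hk4, hk, hS4, hS2]; ring
  have hid : a*x+b*y = (4*C^2-1)^2/9 * (a*C^3+3*b*C^2*S+3*c*C*S^2+d*S^3)
      + (4*(-C/2 - k/2*S)^2-1)^2/9 * (a*(-C/2 - k/2*S)^3+3*b*(-C/2 - k/2*S)^2*(-S/2 + k/2*C)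
        +3*c*(-C/2 - k/2*S)*(-S/2 + k/2*C)^2+d*(-S/2 + k/2*C)^3)
      + (4*(-C/2 + k/2*S)^2-1)^2/9 * (a*(-C/2 + k/2*S)^3+3*b*(-C/2 + k/2*S)^2*(-S/2 - k/2*C)
        +3*c*(-C/2 + k/2*S)*(-S/2 - k/2*C)^2+d*(-S/2 - k/2*C)^3) := by
    rw [h1, h2]
    ring_nf
    simp only [hk6, hk4, hk, hS7, hS6, hS5, hS4, hS3, hS2]
    ring
  rw [abs_le] at f0 f1 f2 ⊢
  rw [hid]
  have hM := congrArg (· * M) hsum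
  simp only [add_mul, one_mul] at hM
  constructor <;> linarith

theorem mixed_coeff_sq_le_of_pos {a b c d A B C : ℝ} (hA : 0 < A) (hdet : 0 < A*C-B^2)
    (h : ∀ x y : ℝ, (a*x^3+3*b*x^2*y+3*c*x*y^2+d*y^3)^2 ≤ 4*(A*x^2+2*B*x*y+C*y^2)^3) :
    b^2 ≤ 4*A^2*C := by
  have hC : 0 < C := by
    by_contra hC
    nlinarith [sq_nonneg B, mul_nonneg hA.le (neg_nonneg.2 (not_lt.1 hC))]
  obtain ⟨α, hα, hαA⟩ : ∃ α : ℝ, 0 < α ∧ α^2 = A := ⟨√A, by positivity, Real.sq_sqrt hA.le⟩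
  obtain ⟨κ, hκ, hκC⟩ : ∃ κ : ℝ, 0 < κ ∧ κ^2 = C := ⟨√C, by positivity, Real.sq_sqrt hC.le⟩
  obtain ⟨δ, hδ, hδD⟩ : ∃ δ : ℝ, 0 < δ ∧ δ^2 = A*C-B^2 :=
    ⟨√(A*C-B^2), by positivity, Real.sq_sqrt hdet.le⟩
  subst hαA hκC
  have key := abs_mixed_coeff_le_of_circle (a := a/α^3) (b := b/(α*δ) - a*B/(α^3*δ))
    (c := (a*(B/(α*δ))^2/α - 2*b*(B/(α*δ))/δ + c*α/δ^2))
    (d := -a*(B/(α*δ))^3 + 3*b*(B/(α*δ))^2*(α/δ) - 3*c*(B/(α*δ))*(α/δ)^2 + d*(α/δ)^3)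
    (M := 2) (B/(α*κ)) (δ/(α*κ)) ?_ ?_
  · have e : a/α^3*(B/(α*κ)) + (b/(α*δ) - a*B/(α^3*δ))*(δ/(α*κ)) = b/(α^2*κ) := by
      field_simp
      ring
    rw [e, abs_div, abs_of_pos (show 0 < α^2*κ by positivity),
      div_le_iff₀ (by positivity)] at key
    calc b^2 = |b|^2 := (sq_abs b).symm
      _ ≤ (2*(α^2*κ))^2 := by gcongr
      _ = _ := by ring
  · field_simp
    linear_combination hδD
  · intro x y hxy
    have h1 := h (x/α - y*(B/(α*δ))) (y*(α/δ))
    have e : α^2*(x/α - y*(B/(α*δ)))^2 + 2*B*(x/α - y*(B/(α*δ)))*(y*(α/δ)) + κ^2*(y*(α/δ))^2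
        = 1 := by
      rw [← hxy]
      field_simp
      linear_combination (-y^2) * hδD
    rw [e] at h1
    refine abs_le_of_sq_le_sq ?_ (by norm_num)
    calc _ = _ := by field_simp; ring
      _ ≤ 4*1^3 := h1
      _ = 2^2 := by norm_num

/-- Polarization of the self-concordance inequality on a plane. -/
theorem mixed_coeff_sq_le {a b c d A B C : ℝ} (hq : ∀ x y : ℝ, 0 ≤ A*x^2+2*B*x*y+C*y^2)
    (h : ∀ x y : ℝ, (a*x^3+3*b*x^2*y+3*c*x*y^2+d*y^3)^2 ≤ 4*(A*x^2+2*B*x*y+C*y^2)^3) :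
    b^2 ≤ 4*A^2*C := by
  have hA : 0 ≤ A := by simpa using hq 1 0
  have hC : 0 ≤ C := by simpa using hq 0 1
  have hdet : B^2 ≤ A*C := by
    have := discrim_le_zero (a := A) (b := 2*B) (c := C) (fun x => by linarith [hq x 1])
    rw [discrim] at this
    linarith
  have hlim : Tendsto (fun ε : ℝ => 4*(A+ε)^2*(C+ε)) (𝓝[>] 0) (𝓝 (4*A^2*C)) := by
    have : Continuous (fun ε : ℝ => 4*(A+ε)^2*(C+ε)) := by fun_prop
    simpa using (this.tendsto 0).mono_left nhdsWithin_le_nhds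
  refine ge_of_tendsto hlim ?_
  filter_upwards [self_mem_nhdsWithin] with ε hε
  have hε : 0 < ε := hε
  refine mixed_coeff_sq_le_of_pos (B := B) (a := a) (c := c) (d := d) (by linarith)
    (by nlinarith) fun x y => (h x y).trans ?_
  have := hq x y
  gcongr 4 * ?_ ^ 3
  nlinarith [mul_nonneg hε.le (sq_nonneg x), mul_nonneg hε.le (sq_nonneg y)]

theorem le_of_hasDerivAt_nonpos {G G' : ℝ → ℝ}
    (hG : ∀ t ∈ Icc (0:ℝ) 1, HasDerivAt G (G' t) t) (hG' : ∀ t ∈ Icc (0:ℝ) 1, G' t ≤ 0)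
    {t : ℝ} (ht : t ∈ Icc (0:ℝ) 1) : G t ≤ G 0 := by
  refine antitoneOn_of_deriv_nonpos (convex_Icc 0 1)
    (fun s hs => (hG s hs).continuousAt.continuousWithinAt)
    (fun s hs => (hG s (interior_subset hs)).differentiableAt.differentiableWithinAt)
    (fun s hs => ?_) (left_mem_Icc.2 zero_le_one) ht ht.1
  rw [(hG s (interior_subset hs)).deriv]
  exact hG' s (interior_subset hs)

/-- If `q' ≤ 2 q ^ (3/2)` and `q 0 < r ^ 2`, then `√(q t) ≤ r / (1 - t r)`. -/
theorem sq_growth_le {q q' : ℝ → ℝ} {r : ℝ} (hr0 : 0 < r) (hr1 : r < 1)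
    (hq : ∀ t ∈ Icc (0:ℝ) 1, HasDerivAt q (q' t) t) (hq0 : ∀ t ∈ Icc (0:ℝ) 1, 0 ≤ q t)
    (hq' : ∀ t ∈ Icc (0:ℝ) 1, q' t ≤ 2 * √(q t) * q t) (hqr : q 0 < r^2)
    {t : ℝ} (ht : t ∈ Icc (0:ℝ) 1) : √(q t) ≤ r/(1-t*r) := by
  set ε := r^2 - q 0 with hε
  have hεp : 0 < ε := by linarith
  have hpos : 0 < 1 - t*r := by nlinarith [ht.1, ht.2]
  have key := le_of_hasDerivAt_nonpos (G := fun t => -t - (√(q t + ε))⁻¹)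
    (G' := fun t => -1 - (-(q' t / (2 * √(q t + ε))) / √(q t + ε)^2)) ?_ ?_ ht
  · simp only [hε, add_sub_cancel, Real.sqrt_sq hr0.le, neg_zero, zero_sub] at key
    rw [← hε] at key
    have hs : 0 < √(q t + ε) := Real.sqrt_pos.2 (by linarith [hq0 t ht])
    have h1 : √(q t) ≤ √(q t + ε) := Real.sqrt_le_sqrt (by linarith)
    refine h1.trans ?_
    have h2 : (1-t*r)/r ≤ (√(q t + ε))⁻¹ := by
      have : (1-t*r)/r = r⁻¹ - t := by field_simp
      rw [this]; linarith
    rw [← inv_div, ← inv_inv (√(q t + ε))]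
    exact inv_anti₀ (by positivity) h2
  · intro s hs
    have hp : 0 < q s + ε := by linarith [hq0 s hs]
    exact (hasDerivAt_id s).neg.sub
      ((((hq s hs).add_const ε).sqrt hp.ne').inv (Real.sqrt_pos.2 hp).ne')
  · intro s hs
    have hp : 0 < q s + ε := by linarith [hq0 s hs]
    have hs' : 0 < √(q s + ε) := Real.sqrt_pos.2 hp
    have h1 : √(q s) ≤ √(q s + ε) := Real.sqrt_le_sqrt (by linarith)
    have h2 : q' s ≤ 2 * √(q s + ε) * √(q s + ε)^2 := by
      refine (hq' s hs).trans ?_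
      rw [Real.sq_sqrt hp.le]
      have := hq0 s hs
      gcongr
      linarith
    have h3 : q' s / (2 * √(q s + ε)) / √(q s + ε)^2 ≤ 1 := by
      rw [div_div, div_le_one (by positivity)]
      exact h2
    simp only [neg_div]
    linarith

theorem sq_transport_le {p p' q : ℝ → ℝ} {r : ℝ} (hr0 : 0 < r) (hr1 : r < 1)
    (hp : ∀ t ∈ Icc (0:ℝ) 1, HasDerivAt p (p' t) t) (hp0 : ∀ t ∈ Icc (0:ℝ) 1, 0 ≤ p t)
    (hp' : ∀ t ∈ Icc (0:ℝ) 1, p' t ≤ 2 * √(q t) * p t)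
    (hq : ∀ t ∈ Icc (0:ℝ) 1, √(q t) ≤ r/(1-t*r))
    {t : ℝ} (ht : t ∈ Icc (0:ℝ) 1) : √(p t) ≤ √(p 0)/(1-t*r) := by
  have hpos : ∀ t ∈ Icc (0:ℝ) 1, 0 < 1 - t*r := fun t ht => by nlinarith [ht.1, ht.2]
  have key := le_of_hasDerivAt_nonpos (G := fun t => p t * (1-t*r)^2)
    (G' := fun t => p' t * (1-t*r)^2 + p t * (2 * (1-t*r) * (-r))) ?_ ?_ ht
  · simp only [zero_mul, sub_zero, one_pow, mul_one] at key
    have := hpos t ht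
    rw [le_div_iff₀ this]
    refine Real.le_sqrt_of_sq_le ?_
    rwa [mul_pow, Real.sq_sqrt (hp0 t ht)]
  · intro s hs
    have h1 : HasDerivAt (fun t : ℝ => 1 - t*r) (-r) s := by
      simpa using ((hasDerivAt_id s).mul_const r).const_sub 1
    exact ((hp s hs).mul (h1.pow 2)).congr_deriv (by simp)
  · intro s hs
    have h0 := hpos s hs
    have h1 : p' s ≤ 2 * (r/(1-s*r)) * p s := by
      refine (hp' s hs).trans ?_
      have := hp0 s hs
      have := hq s hs
      gcongr
    have h2 : p' s * (1-s*r)^2 ≤ 2 * (r/(1-s*r)) * p s * (1-s*r)^2 := by gcongr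
    have h3 : 2 * (r/(1-s*r)) * p s * (1-s*r)^2 = p s * (2 * (1-s*r) * r) := by
      field_simp
    linarith

theorem taylor_remainder_le {m m' m'' : ℝ → ℝ} {r W : ℝ} (hr0 : 0 < r) (hr1 : r < 1)
    (hm : ∀ t ∈ Icc (0:ℝ) 1, HasDerivAt m (m' t) t)
    (hm' : ∀ t ∈ Icc (0:ℝ) 1, HasDerivAt m' (m'' t) t)
    (hm'' : ∀ t ∈ Icc (0:ℝ) 1, m'' t ≤ 2 * (r/(1-t*r))^2 * (W/(1-t*r))) :
    m 1 - m 0 - m' 0 ≤ W * (r^2/(1-r)) := by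
  have hpos : ∀ t ∈ Icc (0:ℝ) 1, 0 < 1 - t*r := fun t ht => by nlinarith [ht.1, ht.2]
  have hd (s : ℝ) : HasDerivAt (fun t : ℝ => 1 - t*r) (-r) s := by
    simpa using ((hasDerivAt_id s).mul_const r).const_sub 1
  have h1 : ∀ t ∈ Icc (0:ℝ) 1, m' t ≤ m' 0 + W * (r/(1-t*r)^2 - r) := by
    intro t ht
    have key := le_of_hasDerivAt_nonpos (G := fun t => m' t - W * (r * ((1-t*r)^2)⁻¹))
      (G' := fun t => m'' t - 2 * (r/(1-t*r))^2 * (W/(1-t*r))) ?_ ?_ ht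
    · simp only [zero_mul, sub_zero, one_pow, inv_one, mul_one] at key
      rw [div_eq_mul_inv]
      linarith
    · intro s hs
      have h0 := hpos s hs
      refine ((hm' s hs).sub (((((hd s).pow 2).inv (pow_pos h0 2).ne').const_mul r).const_mul W)).congr_deriv ?_
      simp only [Pi.pow_apply]
      generalize 1 - s*r = z at h0 ⊢
      field_simp
      ring
    · intro s hs
      linarith [hm'' s hs]
  have key := le_of_hasDerivAt_nonpos
    (G := fun t => m t - (t * m' 0 + W * ((1-t*r)⁻¹ - t * r)))
    (G' := fun t => m' t - (m' 0 + W * (r/(1-t*r)^2 - r))) ?_ ?_ (right_mem_Icc.2 zero_le_one)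
  · simp only [zero_mul, sub_zero, inv_one, mul_one, one_mul, zero_add] at key
    have h2 : r^2/(1-r) = (1-r)⁻¹ - r - 1 := by
      have : 0 < 1 - r := by linarith
      field_simp
      ring
    rw [h2]
    linarith
  · intro s hs
    have h0 := hpos s hs
    refine ((hm s hs).sub (((hasDerivAt_id s).mul_const (m' 0)).add
      ((((hd s).inv h0.ne').sub ((hasDerivAt_id s).mul_const r)).const_mul W))).congr_deriv ?_
    simp
  · intro s hs
    linarith [h1 s hs]

section LineDerivatives

variable {E : Type*} [NormedAddCommGroup E] [NormedSpace ℝ E] {D : Set E} {f : E → ℝ}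

theorem HasFDerivAt.hasDerivAt_line {F : Type*} [NormedAddCommGroup F] [NormedSpace ℝ F]
    {G : E → F} {G' : E →L[ℝ] F} {x v : E} {s : ℝ} (h : HasFDerivAt G G' (x + s • v)) :
    HasDerivAt (fun t : ℝ => G (x + t • v)) (G' v) s := by
  have hl : HasDerivAt (fun t : ℝ => x + t • v) v s := by
    simpa using ((hasDerivAt_id s).smul_const v).const_add x
  exact h.comp_hasDerivAt s hl

theorem HasDerivAt.clm_apply_const {F : Type*} [NormedAddCommGroup F] [NormedSpace ℝ F]
    {c : ℝ → E →L[ℝ] F} {c' : E →L[ℝ] F} {s : ℝ} (h : HasDerivAt c c' s) (v : E) :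
    HasDerivAt (fun t => c t v) (c' v) s := by
  simpa using h.clm_apply (hasDerivAt_const s v)

theorem HasFDerivAt.hasDerivAt_line_apply_apply {G : E → E →L[ℝ] E →L[ℝ] ℝ}
    {G' : E →L[ℝ] E →L[ℝ] E →L[ℝ] ℝ} {x u : E} {s : ℝ} (h : HasFDerivAt G G' (x + s • u))
    (v w : E) : HasDerivAt (fun t : ℝ => G (x + t • u) v w) (G' u v w) s := by
  have h1 : HasDerivAt (fun t : ℝ => G (x + t • u)) (G' u) s :=
    HasFDerivAt.hasDerivAt_line (F := E →L[ℝ] E →L[ℝ] ℝ) (G := G) (G' := G') h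
  have h2 : HasDerivAt (fun t : ℝ => G (x + t • u) v) (G' u v) s := h1.clm_apply_const v
  exact h2.clm_apply_const w

theorem hasFDerivAt_of_contDiffOn_three (hD : IsOpen D) (hf : ContDiffOn ℝ 3 f D) {x : E}
    (hx : x ∈ D) :
    HasFDerivAt f (fderiv ℝ f x) x ∧
      HasFDerivAt (fderiv ℝ f) (fderiv ℝ (fderiv ℝ f) x) x ∧
      HasFDerivAt (fderiv ℝ (fderiv ℝ f)) (fderiv ℝ (fderiv ℝ (fderiv ℝ f)) x) x := by
  have h3 : ContDiffAt ℝ 3 f x := hf.contDiffAt (hD.mem_nhds hx)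
  have h2 : ContDiffAt ℝ 2 (fderiv ℝ f) x := h3.fderiv_right (by norm_num)
  have h1 : ContDiffAt ℝ 1 (fderiv ℝ (fderiv ℝ f)) x := h2.fderiv_right (by norm_num)
  exact ⟨(h3.differentiableAt (by norm_num)).hasFDerivAt,
    (h2.differentiableAt (by norm_num)).hasFDerivAt,
    (h1.differentiableAt (by norm_num)).hasFDerivAt⟩

theorem hasDerivAt_fderiv_line (hD : IsOpen D) (hf : ContDiffOn ℝ 3 f D) {x u : E} {s : ℝ}
    (hx : x + s • u ∈ D) (v : E) :
    HasDerivAt (fun s : ℝ => fderiv ℝ f (x + s • u) v)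
      (fderiv ℝ (fderiv ℝ f) (x + s • u) u v) s :=
  (hasFDerivAt_of_contDiffOn_three hD hf hx).2.1.hasDerivAt_line.clm_apply_const v

theorem hasDerivAt_fderiv_fderiv_line (hD : IsOpen D) (hf : ContDiffOn ℝ 3 f D) {x u : E} {s : ℝ}
    (hx : x + s • u ∈ D) (v w : E) :
    HasDerivAt (fun s : ℝ => fderiv ℝ (fderiv ℝ f) (x + s • u) v w)
      (fderiv ℝ (fderiv ℝ (fderiv ℝ f)) (x + s • u) u v w) s :=
  (hasFDerivAt_of_contDiffOn_three hD hf hx).2.2.hasDerivAt_line_apply_apply v w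

theorem eventually_line_mem (hD : IsOpen D) {x : E} (hx : x ∈ D) (v : E) :
    ∀ᶠ s : ℝ in 𝓝 0, x + s • v ∈ D := by
  have hc : Continuous fun s : ℝ => x + s • v := by fun_prop
  exact hc.continuousAt.preimage_mem_nhds (hD.mem_nhds (by simpa using hx))

theorem iteratedDeriv_line (hD : IsOpen D) (hf : ContDiffOn ℝ 3 f D) {x : E} (hx : x ∈ D) (v : E) :
    iteratedDeriv 2 (fun s : ℝ => f (x + s • v)) 0 = fderiv ℝ (fderiv ℝ f) x v v ∧
    iteratedDeriv 3 (fun s : ℝ => f (x + s • v)) 0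
      = fderiv ℝ (fderiv ℝ (fderiv ℝ f)) x v v v := by
  have hev := (eventually_line_mem hD hx v).eventually_nhds
  have e1 : ∀ s : ℝ, x + s • v ∈ D →
      deriv (fun s : ℝ => f (x + s • v)) s = fderiv ℝ f (x + s • v) v := fun s hs =>
    (hasFDerivAt_of_contDiffOn_three hD hf hs).1.hasDerivAt_line.deriv
  have e2 : ∀ s : ℝ, x + s • v ∈ D → deriv (fun s : ℝ => fderiv ℝ f (x + s • v) v) s
      = fderiv ℝ (fderiv ℝ f) (x + s • v) v v := fun s hs =>
    (hasDerivAt_fderiv_line hD hf hs v).deriv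
  have e3 : ∀ s : ℝ, x + s • v ∈ D →
      deriv (fun s : ℝ => fderiv ℝ (fderiv ℝ f) (x + s • v) v v) s
      = fderiv ℝ (fderiv ℝ (fderiv ℝ f)) (x + s • v) v v v := fun s hs =>
    (hasDerivAt_fderiv_fderiv_line hD hf hs v v).deriv
  have d1 : ∀ᶠ s : ℝ in 𝓝 0, iteratedDeriv 1 (fun s : ℝ => f (x + s • v)) s
      = fderiv ℝ f (x + s • v) v := by
    filter_upwards [hev.self_of_nhds] with s hs
    rw [iteratedDeriv_one, e1 s hs]
  have d2 : ∀ᶠ s : ℝ in 𝓝 0, iteratedDeriv 2 (fun s : ℝ => f (x + s • v)) s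
      = fderiv ℝ (fderiv ℝ f) (x + s • v) v v := by
    filter_upwards [hev.self_of_nhds, d1.eventually_nhds] with s hs h1
    rw [iteratedDeriv_succ, Filter.EventuallyEq.deriv_eq h1, e2 s hs]
  refine ⟨by simpa using d2.self_of_nhds, ?_⟩
  rw [iteratedDeriv_succ, Filter.EventuallyEq.deriv_eq d2, e3 0 (by simpa using hx)]
  simp

theorem ConvexOn.fderiv_fderiv_apply_self_nonneg (hD : IsOpen D) (hconv : ConvexOn ℝ D f)
    (hf : ContDiffOn ℝ 3 f D) {x : E} (hx : x ∈ D) (v : E) :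
    0 ≤ fderiv ℝ (fderiv ℝ f) x v v := by
  set l : ℝ →ᵃ[ℝ] E := AffineMap.lineMap x (x + v)
  have hl : ∀ s : ℝ, l s = x + s • v := fun s => by
    simp [l, AffineMap.lineMap_apply, add_comm]
  have hφ := hconv.comp_affineMap l
  have hfl : f ∘ l = fun s : ℝ => f (x + s • v) := by
    ext s
    simp [hl]
  have hmem : ∀ s ∈ l ⁻¹' D, x + s • v ∈ D := fun s hs => by
    have : l s ∈ D := hs
    rwa [hl] at this
  have hopen : IsOpen (l ⁻¹' D) := by
    have : Continuous l := by
      rw [show (l : ℝ → E) = fun s : ℝ => x + s • v from funext hl]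
      fun_prop
    exact hD.preimage this
  have h0 : (0:ℝ) ∈ l ⁻¹' D := by
    change l 0 ∈ D
    rw [hl]
    simpa using hx
  rw [hfl] at hφ
  have hmono := hφ.monotoneOn_deriv fun s hs =>
    (hasFDerivAt_of_contDiffOn_three hD hf (hmem s hs)).1.hasDerivAt_line.differentiableAt
  rw [← (iteratedDeriv_line hD hf hx v).1, iteratedDeriv_succ, iteratedDeriv_one,
    ← derivWithin_of_isOpen hopen h0]
  exact hmono.derivWithin_nonneg

theorem fderiv_fderiv_symm (hD : IsOpen D) (hf : ContDiffOn ℝ 3 f D) {x : E} (hx : x ∈ D)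
    (v w : E) : fderiv ℝ (fderiv ℝ f) x v w = fderiv ℝ (fderiv ℝ f) x w v := by
  refine second_derivative_symmetric_of_eventually_of_real (f := f) (f' := fderiv ℝ f) (x := x)
    ?_ (hasFDerivAt_of_contDiffOn_three hD hf hx).2.1 v w
  filter_upwards [hD.mem_nhds hx] with y hy
  exact (hasFDerivAt_of_contDiffOn_three hD hf hy).1

theorem fderiv_fderiv_fderiv_symm_left (hD : IsOpen D) (hf : ContDiffOn ℝ 3 f D) {x : E}
    (hx : x ∈ D) (u v w : E) :
    fderiv ℝ (fderiv ℝ (fderiv ℝ f)) x u v w = fderiv ℝ (fderiv ℝ (fderiv ℝ f)) x v u w := by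
  refine congrArg (· w) (second_derivative_symmetric_of_eventually_of_real
    (f := fderiv ℝ f) (f' := fderiv ℝ (fderiv ℝ f)) (x := x)
    ?_ (hasFDerivAt_of_contDiffOn_three hD hf hx).2.2 u v)
  filter_upwards [hD.mem_nhds hx] with y hy
  exact (hasFDerivAt_of_contDiffOn_three hD hf hy).2.1

theorem fderiv_fderiv_fderiv_symm_right (hD : IsOpen D) (hf : ContDiffOn ℝ 3 f D) {x : E}
    (hx : x ∈ D) (u v w : E) :
    fderiv ℝ (fderiv ℝ (fderiv ℝ f)) x u v w = fderiv ℝ (fderiv ℝ (fderiv ℝ f)) x u w v := by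
  have hx0 : x + (0:ℝ) • u ∈ D := by simpa using hx
  have h1 := hasDerivAt_fderiv_fderiv_line hD hf hx0 v w
  have h2 := hasDerivAt_fderiv_fderiv_line hD hf hx0 w v
  have h3 : (fun s : ℝ => fderiv ℝ (fderiv ℝ f) (x + s • u) v w) =ᶠ[𝓝 0]
      fun s : ℝ => fderiv ℝ (fderiv ℝ f) (x + s • u) w v := by
    filter_upwards [eventually_line_mem hD hx u] with s hs
    exact fderiv_fderiv_symm hD hf hs v w
  simpa using h1.unique (h2.congr_of_eventuallyEq h3)

/-- The self-concordance inequality in mixed directions. -/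
theorem abs_fderiv_fderiv_fderiv_le (hD : IsOpen D) (hconv : ConvexOn ℝ D f)
    (hf : ContDiffOn ℝ 3 f D)
    (hsc : ∀ x ∈ D, ∀ v : E, ∀ t : ℝ, x + t • v ∈ D →
      |iteratedDeriv 3 (fun s : ℝ => f (x + s • v)) t| ≤
        2 * iteratedDeriv 2 (fun s : ℝ => f (x + s • v)) t ^ ((3 : ℝ) / 2))
   {x : E} (hx : x ∈ D) (h v : E) :
    |fderiv ℝ (fderiv ℝ (fderiv ℝ f)) x h v v| ≤
      2 * √(fderiv ℝ (fderiv ℝ f) x h h) * fderiv ℝ (fderiv ℝ f) x v v := by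
  have hQ0 := fun v => hconv.fderiv_fderiv_apply_self_nonneg hD hf hx v
  have hQs := fderiv_fderiv_symm hD hf hx
  have hTl := fderiv_fderiv_fderiv_symm_left hD hf hx
  have hTr := fderiv_fderiv_fderiv_symm_right hD hf hx
  have hT : ∀ u, (fderiv ℝ (fderiv ℝ (fderiv ℝ f)) x u u u)^2 ≤
      4 * (fderiv ℝ (fderiv ℝ f) x u u)^3 := by
    intro u
    have h1 := hsc x hx u 0 (by simpa using hx)
    rw [(iteratedDeriv_line hD hf hx u).1, (iteratedDeriv_line hD hf hx u).2] at h1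
    calc _ = |fderiv ℝ (fderiv ℝ (fderiv ℝ f)) x u u u|^2 := (sq_abs _).symm
      _ ≤ (2 * (fderiv ℝ (fderiv ℝ f) x u u) ^ ((3 : ℝ) / 2))^2 := by gcongr
      _ = _ := by
        rw [mul_pow, ← Real.rpow_natCast (_ ^ ((3:ℝ)/2)), ← Real.rpow_mul (hQ0 u)]
        norm_num
  generalize fderiv ℝ (fderiv ℝ (fderiv ℝ f)) x = T at *
  generalize fderiv ℝ (fderiv ℝ f) x = Q at *
  have eQ (s t : ℝ) : Q (s • v + t • h) (s • v + t • h)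
      = Q v v * s^2 + 2 * Q v h * s * t + Q h h * t^2 := by
    simp only [map_add, map_smul, _root_.add_apply, _root_.smul_apply,
      smul_eq_mul, hQs h v]
    ring
  have eT (s t : ℝ) : T (s • v + t • h) (s • v + t • h) (s • v + t • h)
      = T v v v * s^3 + 3 * T h v v * s^2 * t + 3 * T h h v * s * t^2 + T h h h * t^3 := by
    simp only [map_add, map_smul, _root_.add_apply, _root_.smul_apply,
      smul_eq_mul, hTl v h v, hTr v v h, hTl v h h, hTr h v h]
    ring
  have key := mixed_coeff_sq_le (A := Q v v) (B := Q v h) (C := Q h h) (a := T v v v)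
    (b := T h v v) (c := T h h v) (d := T h h h) (fun s t => by rw [← eQ]; exact hQ0 _)
    (fun s t => by rw [← eQ, ← eT]; exact hT _)
  have hv := hQ0 v
  refine abs_le_of_sq_le_sq ?_ (by positivity)
  rw [mul_pow, mul_pow, Real.sq_sqrt (hQ0 h)]
  linarith

/-- First-order Taylor remainder bound for the gradient of a self-concordant function. -/
theorem fderiv_sub_sub_le (hD : IsOpen D) (hconvex : Convex ℝ D) (hconv : ConvexOn ℝ D f)
    (hf : ContDiffOn ℝ 3 f D)
    (hsc : ∀ x ∈ D, ∀ v : E, ∀ t : ℝ, x + t • v ∈ D →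
      |iteratedDeriv 3 (fun s : ℝ => f (x + s • v)) t| ≤
        2 * iteratedDeriv 2 (fun s : ℝ => f (x + s • v)) t ^ ((3 : ℝ) / 2))
   {x y : E} (hx : x ∈ D) (hy : y ∈ D) {r : ℝ} (hr0 : 0 < r) (hr1 : r < 1)
    (hr : fderiv ℝ (fderiv ℝ f) x (y - x) (y - x) < r^2) (w : E) :
    fderiv ℝ f y w - fderiv ℝ f x w - fderiv ℝ (fderiv ℝ f) x (y - x) w ≤
      √(fderiv ℝ (fderiv ℝ f) x w w) * (r^2/(1-r)) := by
  set h := y - x with hh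
  have hmem : ∀ t ∈ Icc (0:ℝ) 1, x + t • h ∈ D := fun t ht => by
    exact hconvex.add_smul_sub_mem hx hy ht
  have hQ0 (v : E) : ∀ t ∈ Icc (0:ℝ) 1, 0 ≤ fderiv ℝ (fderiv ℝ f) (x + t • h) v v := fun t ht =>
    hconv.fderiv_fderiv_apply_self_nonneg hD hf (hmem t ht) v
  have hT := fun t ht => abs_fderiv_fderiv_fderiv_le hD hconv hf hsc (hmem t ht)
  have hder := fun t ht => hasDerivAt_fderiv_fderiv_line hD hf (hmem t ht)
  have hqh : ∀ t ∈ Icc (0:ℝ) 1, √(fderiv ℝ (fderiv ℝ f) (x + t • h) h h) ≤ r/(1-t*r) :=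
    fun t ht => sq_growth_le hr0 hr1 (fun t ht => hder t ht h h) (hQ0 h)
      (fun t ht => (abs_le.1 (hT t ht h h)).2) (by simpa using hr) ht
  have hqw : ∀ t ∈ Icc (0:ℝ) 1, √(fderiv ℝ (fderiv ℝ f) (x + t • h) w w) ≤
      √(fderiv ℝ (fderiv ℝ f) x w w)/(1-t*r) := fun t ht => by
    simpa using sq_transport_le hr0 hr1 (fun t ht => hder t ht w w) (hQ0 w)
      (fun t ht => (abs_le.1 (hT t ht h w)).2) hqh ht
  have key := taylor_remainder_le (W := √(fderiv ℝ (fderiv ℝ f) x w w)) hr0 hr1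
    (m := fun t => fderiv ℝ f (x + t • h) w)
    (m' := fun t => fderiv ℝ (fderiv ℝ f) (x + t • h) h w)
    (fun t ht => hasDerivAt_fderiv_line hD hf (hmem t ht) w)
    (fun t ht => hder t ht h w) (fun t ht => ?_)
  · simpa [hh] using key
  · have hpos : 0 < 1 - t*r := by nlinarith [ht.1, ht.2]
    rw [fderiv_fderiv_fderiv_symm_right hD hf (hmem t ht),
      fderiv_fderiv_fderiv_symm_left hD hf (hmem t ht)]
    refine (abs_le.1 (hT t ht w h)).2.trans ?_
    have h1 := hqh t ht
    have h2 := hqw t ht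
    have h3 := Real.sq_sqrt (hQ0 h t ht)
    calc _ = 2 * √(fderiv ℝ (fderiv ℝ f) (x + t • h) h h)^2
          * √(fderiv ℝ (fderiv ℝ f) (x + t • h) w w) := by rw [h3]; ring
      _ ≤ _ := by gcongr

end LineDerivatives

theorem mDualNorm_nonneg {n : ℕ} (H : Matrix (Fin n) (Fin n) ℝ) (z : Fin n → ℝ) :
    0 ≤ mDualNorm H z := Real.sqrt_nonneg _

theorem mNorm_nonneg {n : ℕ} (H : Matrix (Fin n) (Fin n) ℝ) (z : Fin n → ℝ) :
    0 ≤ mNorm H z := Real.sqrt_nonneg _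

theorem mNorm_neg {n : ℕ} (H : Matrix (Fin n) (Fin n) ℝ) (z : Fin n → ℝ) :
    mNorm H (-z) = mNorm H z := by
  simp [mNorm, mulVec_neg]

theorem Matrix.PosDef.dotProduct_mulVec_self_nonneg {n : ℕ} {H : Matrix (Fin n) (Fin n) ℝ}
    (hH : H.PosDef) (z : Fin n → ℝ) : 0 ≤ z ⬝ᵥ H *ᵥ z := by
  simpa using hH.posSemidef.dotProduct_mulVec_nonneg z

theorem Matrix.PosDef.dotProduct_mulVec_symm {n : ℕ} {H : Matrix (Fin n) (Fin n) ℝ}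
    (hH : H.PosDef) (y z : Fin n → ℝ) : y ⬝ᵥ H *ᵥ z = z ⬝ᵥ H *ᵥ y := by
  have hT : Hᵀ = H := by simpa using hH.isHermitian.eq
  rw [dotProduct_mulVec, ← mulVec_transpose, hT, dotProduct_comm]

/-- Cauchy–Schwarz inequality for the local norm and its dual. -/
theorem dotProduct_le_mDualNorm_mul_mNorm {n : ℕ} {H : Matrix (Fin n) (Fin n) ℝ}
    (hH : H.PosDef) (a z : Fin n → ℝ) : a ⬝ᵥ z ≤ mDualNorm H a * mNorm H z := by
  have hdet : IsUnit H.det := isUnit_iff_ne_zero.2 hH.det_pos.ne'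
  set b := H⁻¹ *ᵥ a with hb
  have hHb : H *ᵥ b = a := by
    rw [hb, mulVec_mulVec, mul_nonsing_inv _ hdet, one_mulVec]
  have hbz : z ⬝ᵥ H *ᵥ b = a ⬝ᵥ z := by rw [hHb, dotProduct_comm]
  have hbb : b ⬝ᵥ H *ᵥ b = a ⬝ᵥ b := by rw [hHb, dotProduct_comm]
  have hdisc := discrim_le_zero (a := a ⬝ᵥ b) (b := 2 * (a ⬝ᵥ z)) (c := z ⬝ᵥ H *ᵥ z) fun t => by
    have := hH.dotProduct_mulVec_self_nonneg (t • b + z)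
    simp only [mulVec_add, mulVec_smul, dotProduct_add, add_dotProduct, smul_dotProduct,
      dotProduct_smul, smul_eq_mul, hbz, hbb, hH.dotProduct_mulVec_symm b z] at this
    linarith
  rw [discrim] at hdisc
  have h0 : 0 ≤ a ⬝ᵥ b := hbb ▸ hH.dotProduct_mulVec_self_nonneg b
  rw [mDualNorm, mNorm, ← hb, ← Real.sqrt_mul h0]
  exact Real.le_sqrt_of_sq_le (by linarith)

theorem IsProxPt.ne_top {n : ℕ} {H : Matrix (Fin n) (Fin n) ℝ} {g : (Fin n → ℝ) → EReal}
    {u p z : Fin n → ℝ} (hp : IsProxPt H g u p) (hz : g z ≠ ⊤) : g p ≠ ⊤ := by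
  intro h
  have := hp z
  rw [proxObj, proxObj, h, EReal.top_add_coe, top_le_iff] at this
  exact EReal.add_ne_top hz (EReal.coe_ne_top _) this

/-- The variational inequality characterizing a proximal point. -/
theorem IsProxPt.add_dotProduct_le {n : ℕ} {H : Matrix (Fin n) (Fin n) ℝ} (hH : H.PosDef)
    {g : (Fin n → ℝ) → EReal} (hg : EConvex g) {u p z : Fin n → ℝ} (hp : IsProxPt H g u p)
    {P Z : ℝ} (hP : g p = P) (hZ : g z = Z) :
    P + (u - H *ᵥ p) ⬝ᵥ (z - p) ≤ Z := by
  have hstep : ∀ t : ℝ, 0 < t → t ≤ 1 →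
      P + (u - H *ᵥ p) ⬝ᵥ (z - p) ≤ Z + t * (1/2 * ((z - p) ⬝ᵥ H *ᵥ (z - p))) := by
    intro t ht0 ht1
    have hc := hg p z (1-t) t (by linarith) ht0.le (by ring)
    have hm := hp ((1-t) • p + t • z)
    have e : (1-t) • p + t • z = p + t • (z - p) := by module
    rw [e] at hc hm
    rw [proxObj, proxObj, hP] at hm
    rw [hP, hZ] at hc
    have hm2 := hm.trans (add_le_add_left hc _)
    norm_cast at hm2
    simp only [mulVec_add, mulVec_smul, dotProduct_add, add_dotProduct, smul_dotProduct,
      dotProduct_smul, smul_eq_mul, hH.dotProduct_mulVec_symm p (z - p)] at hm2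
    rw [sub_dotProduct, dotProduct_comm (H *ᵥ p)]
    refine le_of_mul_le_mul_left ?_ ht0
    linarith
  have hlim : Tendsto (fun t : ℝ => Z + t * (1/2 * ((z - p) ⬝ᵥ H *ᵥ (z - p)))) (𝓝[>] 0)
      (𝓝 Z) := by
    have : Continuous (fun t : ℝ => Z + t * (1/2 * ((z - p) ⬝ᵥ H *ᵥ (z - p)))) := by fun_prop
    simpa using (this.tendsto 0).mono_left nhdsWithin_le_nhds
  refine ge_of_tendsto hlim ?_
  filter_upwards [Ioc_mem_nhdsGT (show (0:ℝ) < 1 by norm_num)] with t ht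
  exact hstep t ht.1 ht.2

theorem fderiv_fderiv_eq_dotProduct_mulVec {n : ℕ} {D : Set (Fin n → ℝ)} {f : (Fin n → ℝ) → ℝ}
    {f' : (Fin n → ℝ) → Fin n → ℝ} {f'' : (Fin n → ℝ) → Matrix (Fin n) (Fin n) ℝ}
    (hD : IsOpen D) (hf : ContDiffOn ℝ 3 f D)
    (hgrad : ∀ x ∈ D, HasFDerivAt f (dotCLM (f' x)) x)
    (hhess : ∀ x ∈ D, HasFDerivAt f' (LinearMap.toContinuousLinearMap (f'' x).mulVecLin) x)
    {x : Fin n → ℝ} (hx : x ∈ D) (v w : Fin n → ℝ) :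
    fderiv ℝ (fderiv ℝ f) x v w = w ⬝ᵥ f'' x *ᵥ v := by
  have hx0 : x + (0:ℝ) • v ∈ D := by simpa using hx
  have h1 := hasDerivAt_fderiv_line hD hf hx0 w
  have h2 : HasDerivAt (fun t : ℝ => dotCLM w (f' (x + t • v)))
      (dotCLM w (f'' (x + (0:ℝ) • v) *ᵥ v)) 0 :=
    (dotCLM w).hasFDerivAt.comp_hasDerivAt 0 (hhess _ hx0).hasDerivAt_line
  have h3 : (fun t : ℝ => fderiv ℝ f (x + t • v) w) =ᶠ[𝓝 0]
      fun t : ℝ => dotCLM w (f' (x + t • v)) := by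
    filter_upwards [eventually_line_mem hD hx v] with t ht
    rw [(hgrad _ ht).fderiv]
    exact dotProduct_comm (f' (x + t • v)) w
  have h4 := h1.unique (h2.congr_of_eventuallyEq h3)
  rw [zero_smul, add_zero] at h4
  exact h4

theorem StdSelfConcordantOn.gradient_remainder_le {n : ℕ} {D : Set (Fin n → ℝ)}
    {f : (Fin n → ℝ) → ℝ}
    {f' : (Fin n → ℝ) → Fin n → ℝ} {f'' : (Fin n → ℝ) → Matrix (Fin n) (Fin n) ℝ}
    (hf : StdSelfConcordantOn D f)
    (hgrad : ∀ x ∈ D, HasFDerivAt f (dotCLM (f' x)) x)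
    (hhess : ∀ x ∈ D, HasFDerivAt f' (LinearMap.toContinuousLinearMap (f'' x).mulVecLin) x)
    {x y : Fin n → ℝ} (hx : x ∈ D) (hy : y ∈ D) (hr : mNorm (f'' x) (y - x) < 1)
    (w : Fin n → ℝ) :
    w ⬝ᵥ (f' y - f' x - f'' x *ᵥ (y - x)) ≤
      mNorm (f'' x) w * (mNorm (f'' x) (y - x) ^ 2 / (1 - mNorm (f'' x) (y - x))) := by
  obtain ⟨hD, hconvex, hconv, hcd, hsc⟩ := hf
  set r := mNorm (f'' x) (y - x) with hrdef
  have hr0 : 0 ≤ r := mNorm_nonneg _ _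
  have hQ := fderiv_fderiv_eq_dotProduct_mulVec hD hcd hgrad hhess hx
  have hlim : Tendsto (fun s : ℝ => mNorm (f'' x) w * (s^2/(1-s))) (𝓝[>] r)
      (𝓝 (mNorm (f'' x) w * (r^2/(1-r)))) := by
    have : ContinuousAt (fun s : ℝ => mNorm (f'' x) w * (s^2/(1-s))) r := by
      have : 1 - r ≠ 0 := by linarith
      fun_prop (disch := assumption)
    exact this.tendsto.mono_left nhdsWithin_le_nhds
  refine ge_of_tendsto hlim ?_
  filter_upwards [Ioo_mem_nhdsGT hr] with s hs
  have hs0 : 0 < s := hr0.trans_lt hs.1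
  have key := fderiv_sub_sub_le hD hconvex hconv hcd hsc hx hy hs0 hs.2
    (by rw [hQ]; exact (Real.sqrt_lt' hs0).1 hs.1) w
  rw [hQ, hQ, (hgrad y hy).fderiv, (hgrad x hx).fderiv] at key
  refine le_trans (le_of_eq ?_) key
  rw [dotProduct_sub, dotProduct_sub, dotProduct_comm w (f' y), dotProduct_comm w (f' x)]
  rfl

/-- Key estimate: for `x^k ∈ dom F` with `r_k = ‖x^k − x*‖_{x*} < 1`,
a symmetric positive definite `H_k` and `s^k = P^g_{H_k}(H_k x^k − ∇f(x^k))`, one has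
`‖s^k − x*‖_{x*} ≤ r_k²/(1 − r_k) + ‖(H_k − ∇²f(x*)) d^k‖*_{x*}`. -/
theorem key_distance_estimate
    (n : ℕ) (D : Set (Fin n → ℝ)) (f : (Fin n → ℝ) → ℝ)
    (f' : (Fin n → ℝ) → Fin n → ℝ)
    (f'' : (Fin n → ℝ) → Matrix (Fin n) (Fin n) ℝ)
    (hf : StdSelfConcordantOn D f)
    (hgrad : ∀ x ∈ D, HasFDerivAt f (dotCLM (f' x)) x)
    (hhess : ∀ x ∈ D,
      HasFDerivAt f' (LinearMap.toContinuousLinearMap (f'' x).mulVecLin) x)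
    (g : (Fin n → ℝ) → EReal) (hg_proper : EProper g)
    (hg_lsc : LowerSemicontinuous g) (hg_conv : EConvex g)
    (xs : Fin n → ℝ) (hxsD : xs ∈ D)
    (hopt : ESubgradAt g (-(f' xs)) xs) (hxs_pd : (f'' xs).PosDef)
    (xk : Fin n → ℝ) (hxkD : xk ∈ D) (hxkg : g xk ≠ ⊤)
    (hrk : mNorm (f'' xs) (xk - xs) < 1)
    (Hk : Matrix (Fin n) (Fin n) ℝ) (hHk : Hk.PosDef)
    (sk dk : Fin n → ℝ) (hsk : IsProxPt Hk g (Hk.mulVec xk - f' xk) sk)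
    (hdk : dk = sk - xk) :
    mNorm (f'' xs) (sk - xs) ≤
      mNorm (f'' xs) (xk - xs) ^ 2 / (1 - mNorm (f'' xs) (xk - xs)) +
        mDualNorm (f'' xs) ((Hk - f'' xs).mulVec dk) := by
  have hopt2 := hopt.2 sk
  have hsk_top : g sk ≠ ⊤ := hsk.ne_top hxkg
  have hsk_coe : g sk = ((g sk).toReal : EReal) :=
    (EReal.coe_toReal hsk_top (hg_proper.1 sk)).symm
  have hxs_coe : g xs = ((g xs).toReal : EReal) :=
    (EReal.coe_toReal hopt.1 (hg_proper.1 xs)).symm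
  have hvar := hsk.add_dotProduct_le hHk hg_conv hsk_coe hxs_coe
  rw [hsk_coe, hxs_coe] at hopt2
  norm_cast at hopt2
  have hrem := hf.gradient_remainder_le hgrad hhess hxsD hxkD hrk (-(sk - xs))
  have hcs := dotProduct_le_mDualNorm_mul_mNorm hxs_pd ((Hk - f'' xs) *ᵥ dk) (-(sk - xs))
  rw [mNorm_neg] at hrem hcs
  have hz : mNorm (f'' xs) (sk - xs) ^ 2 = (sk - xs) ⬝ᵥ f'' xs *ᵥ (sk - xs) :=
    Real.sq_sqrt (hxs_pd.dotProduct_mulVec_self_nonneg _)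
  have hsplit : (sk - xs) ⬝ᵥ f'' xs *ᵥ (sk - xs) =
      ((Hk - f'' xs) *ᵥ dk) ⬝ᵥ (-(sk - xs))
      + (-(sk - xs)) ⬝ᵥ (f' xk - f' xs - f'' xs *ᵥ (xk - xs))
      + ((Hk *ᵥ xk - f' xk - Hk *ᵥ sk) ⬝ᵥ (xs - sk) + (-(f' xs)) ⬝ᵥ (sk - xs)) := by
    rw [dotProduct_comm ((Hk - f'' xs) *ᵥ dk), dotProduct_comm _ (xs - sk),
      dotProduct_comm (-(f' xs)), ← neg_sub sk xs, hdk]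
    simp only [neg_dotProduct, ← dotProduct_neg, ← dotProduct_add]
    congr 1
    simp only [sub_mulVec, mulVec_sub]
    abel
  set N := mNorm (f'' xs) (sk - xs)
  set R := mNorm (f'' xs) (xk - xs)
  set A := mDualNorm (f'' xs) ((Hk - f'' xs) *ᵥ dk)
  have hN : 0 ≤ N := mNorm_nonneg _ _
  have hA : 0 ≤ A := mDualNorm_nonneg _ _
  have hR : 0 ≤ R ^ 2 / (1 - R) := div_nonneg (sq_nonneg _) (by linarith)
  have hmain : N * N ≤ N * (R ^ 2 / (1 - R) + A) := by linarith
  rcases hN.eq_or_lt with h0 | h0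
  · linarith
  · exact le_of_mul_le_mul_left hmain h0
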